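/- Let D be an n-atomic domain and a, b ∈ D^#. Then every irreducible element of D that divides a or divides b also divides ab (so V(S(a)) ∪ V(S(b)) ⊆ V(S(ab)) up to association). Moreover, if D is an n-UFD, then every irreducible divisor of ab divides a or divides b, so that (up to association) V(S(ab)) = V(S(a)) ∪ V(S(b)). -/

import Mathlib

/-- `a` is a nonzero nonunit (membership in `D^#`). -/
def NNU {D : Type*} [Ring D] (a : D) : Prop := a ≠ 0 ∧ ¬ IsUnit a

/-- `a ∣ b` in the sense of the paper: `b = c * a * d` for some `c, d`. -/
def PDvd {D : Type*} [Ring D] (a b : D) : Prop := ∃ c d : D, b = c * a * d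

/-- `a ~ b`: `a = u * b * v` for units `u, v`. -/
def PAssoc {D : Type*} [Ring D] (a b : D) : Prop :=
  ∃ u v : Dˣ, a = (u : D) * b * (v : D)

/-- `a` is irreducible: a nonzero nonunit that is not a product of two nonunits. -/
def PIrred {D : Type*} [Ring D] (a : D) : Prop :=
  NNU a ∧ ∀ y z : D, a = y * z → IsUnit y ∨ IsUnit z

/-- `a` is normal: `aD = Da`. -/
def PNormal {D : Type*} [Ring D] (a : D) : Prop :=
  {x : D | ∃ d : D, x = a * d} = {x : D | ∃ d : D, x = d * a}
/-- `D` is n-atomic: every nonzero nonunit is a product of normal irreducible elements. -/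
def NAtomic (D : Type*) [Ring D] : Prop :=
  ∀ a : D, NNU a → ∃ l : List D, l ≠ [] ∧ (∀ p ∈ l, PNormal p ∧ PIrred p) ∧ a = l.prod

/-- A factorization of `r` into normal irreducible elements. -/
def NFactorization {D : Type*} [Ring D] (r : D) (l : List D) : Prop :=
  (∀ p ∈ l, PNormal p ∧ PIrred p) ∧ r = l.prod

/-- `D` is an n-UFD: n-atomic, and factorizations into normal irreducibles are
unique up to order and associates. -/
def NUFD (D : Type*) [Ring D] : Prop :=
  NAtomic D ∧ ∀ r : D, NNU r → ∀ l t : List D, NFactorization r l → NFactorization r t →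
    ∃ σ : Fin l.length ≃ Fin t.length, ∀ i, PAssoc (l.get i) (t.get (σ i))

theorem PDvd.trans {D : Type*} [Ring D] {a b c : D} (h : PDvd a b) (h' : PDvd b c) :
    PDvd a c := by
  obtain ⟨x, y, rfl⟩ := h
  obtain ⟨z, w, rfl⟩ := h'
  exact ⟨z * x, y * w, by simp only [mul_assoc]⟩

theorem PAssoc.pDvd {D : Type*} [Ring D] {a b : D} (h : PAssoc a b) : PDvd b a := by
  obtain ⟨u, v, h⟩ := h
  exact ⟨u, v, h⟩

theorem PAssoc.symm {D : Type*} [Ring D] {a b : D} (h : PAssoc a b) : PAssoc b a := by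
  obtain ⟨u, v, rfl⟩ := h
  exact ⟨u⁻¹, v⁻¹, by simp [mul_assoc]⟩

theorem PDvd.of_mem_list {D : Type*} [Ring D] {p : D} {l : List D} (h : p ∈ l) :
    PDvd p l.prod := by
  obtain ⟨s, t, rfl⟩ := List.append_of_mem h
  exact ⟨s.prod, t.prod, by simp [mul_assoc]⟩

theorem pNormal_iff {D : Type*} [Ring D] {a : D} :
    PNormal a ↔ (∀ d, ∃ e, a * d = e * a) ∧ ∀ d, ∃ e, d * a = a * e := by
  simp only [PNormal, Set.ext_iff, Set.mem_ofPred_eq]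
  constructor
  · intro h
    exact ⟨fun d => (h _).1 ⟨d, rfl⟩, fun d => (h _).2 ⟨d, rfl⟩⟩
  · rintro ⟨h, h'⟩ x
    constructor
    · rintro ⟨d, rfl⟩
      exact h d
    · rintro ⟨d, rfl⟩
      exact h' d

theorem PNormal.mul {D : Type*} [Ring D] {a b : D} (ha : PNormal a) (hb : PNormal b) :
    PNormal (a * b) := by
  rw [pNormal_iff] at *
  constructor
  · intro d
    obtain ⟨e, he⟩ := hb.1 d
    obtain ⟨f, hf⟩ := ha.1 e
    exact ⟨f, by rw [mul_assoc, he, ← mul_assoc, hf, mul_assoc]⟩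
  · intro d
    obtain ⟨e, he⟩ := ha.2 d
    obtain ⟨f, hf⟩ := hb.2 e
    exact ⟨f, by rw [← mul_assoc, he, mul_assoc, hf, mul_assoc]⟩

theorem Units.pNormal {D : Type*} [Ring D] (u : Dˣ) : PNormal (u : D) :=
  pNormal_iff.2 ⟨fun d => ⟨u * d * ↑u⁻¹, by simp⟩, fun d => ⟨↑u⁻¹ * (d * u), by simp⟩⟩

theorem PNormal.of_pAssoc {D : Type*} [Ring D] {a b : D} (hb : PNormal b) (h : PAssoc a b) :
    PNormal a := by
  obtain ⟨u, v, rfl⟩ := h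
  exact (u.pNormal.mul hb).mul v.pNormal

theorem PIrred.of_pAssoc {D : Type*} [Ring D] {a b : D} (hb : PIrred b) (h : PAssoc a b) :
    PIrred a := by
  obtain ⟨u, v, rfl⟩ := h
  obtain ⟨⟨h0, hu⟩, hirr⟩ := hb
  refine ⟨⟨by simpa using h0, by simpa using hu⟩, fun y z hyz => ?_⟩
  have key : b = (↑u⁻¹ * y) * (z * ↑v⁻¹) := by
    calc b = ↑u⁻¹ * (u * b * v) * ↑v⁻¹ := by simp [mul_assoc]
      _ = _ := by rw [hyz]; simp only [mul_assoc]
  simpa using hirr _ _ key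

/-- In an n-atomic ring every irreducible element is normal. -/
theorem NAtomic.pNormal {D : Type*} [Ring D] (hat : NAtomic D) {y : D} (hy : PIrred y) :
    PNormal y := by
  obtain ⟨l, hne, hl, rfl⟩ := hat y hy.1
  obtain _ | ⟨p, t⟩ := l
  · exact absurd rfl hne
  have hp := hl p List.mem_cons_self
  rw [List.prod_cons] at hy ⊢
  obtain h | ⟨u, hu⟩ := hy.2 _ _ rfl
  · exact absurd h hp.2.1.2
  · exact hu ▸ hp.1.mul u.pNormal

/-- A nonzero multiple of an irreducible element has a factorization into normal irreducibles
in which an associate of that element occurs. -/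
theorem NAtomic.exists_nFactorization_mem {D : Type*} [Ring D] (hat : NAtomic D) {c y d : D}
    (hy : PIrred y) (hc : c ≠ 0) (hd : d ≠ 0) :
    ∃ l, NFactorization (c * y * d) l ∧ ∃ p ∈ l, PAssoc p y := by
  have split (x : D) (hx : x ≠ 0) : IsUnit x ∨ ∃ l, NFactorization x l := by
    by_cases hu : IsUnit x
    · exact .inl hu
    · obtain ⟨l, -, hl⟩ := hat x ⟨hx, hu⟩
      exact .inr ⟨l, hl⟩
  have single {p : D} (h : PAssoc p y) : PNormal p ∧ PIrred p :=
    ⟨(hat.pNormal hy).of_pAssoc h, hy.of_pAssoc h⟩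
  obtain ⟨u, rfl⟩ | ⟨s, hs, rfl⟩ := split c hc <;>
    obtain ⟨v, rfl⟩ | ⟨t, ht, rfl⟩ := split d hd
  · have h : PAssoc (u * y * v) y := ⟨u, v, rfl⟩
    exact ⟨[u * y * v], ⟨by simpa using single h, by simp⟩, _, by simp, h⟩
  · have h : PAssoc (u * y) y := ⟨u, 1, by simp⟩
    refine ⟨u * y :: t, ⟨?_, by simp⟩, _, by simp, h⟩
    exact List.forall_mem_cons.2 ⟨single h, ht⟩
  · have h : PAssoc (y * v) y := ⟨1, v, by simp⟩
    refine ⟨s ++ [y * v], ⟨?_, by simp [mul_assoc]⟩, _, by simp, h⟩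
    exact List.forall_mem_append.2 ⟨hs, by simpa using single h⟩
  · have h : PAssoc y y := ⟨1, 1, by simp⟩
    refine ⟨s ++ y :: t, ⟨?_, by simp [mul_assoc]⟩, _, by simp, h⟩
    exact List.forall_mem_append.2 ⟨hs, List.forall_mem_cons.2 ⟨single h, ht⟩⟩

theorem NNU.mul {D : Type*} [Ring D] [IsDomain D] {a b : D} (ha : NNU a) (hb : NNU b) :
    NNU (a * b) :=
  ⟨mul_ne_zero ha.1 hb.1, fun h => ha.2 (isUnit_of_mul_isUnit_left h)⟩

/-- In an n-atomic domain, every irreducible dividing `a` or `b`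
divides `ab`; and if `D` is an n-UFD, every irreducible divisor of `ab`
divides `a` or divides `b`. -/
theorem vertices_of_product {D : Type*} [Ring D] [IsDomain D]
    (hat : NAtomic D) (a b : D) (ha : NNU a) (hb : NNU b) :
    (∀ y : D, PIrred y → (PDvd y a ∨ PDvd y b) → PDvd y (a * b)) ∧
    (NUFD D → ∀ y : D, PIrred y → PDvd y (a * b) → PDvd y a ∨ PDvd y b) := by
  constructor
  · rintro y - (h | h)
    · exact h.trans ⟨1, b, by simp⟩
    · exact h.trans ⟨a, 1, by simp⟩
  · rintro ⟨-, huniq⟩ y hy ⟨c, d, hcd⟩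
    have hab := ha.mul hb
    have h0 : c * y * d ≠ 0 := hcd ▸ hab.1
    obtain ⟨l, hl, p, hpl, hpy⟩ := hat.exists_nFactorization_mem hy
      (left_ne_zero_of_mul (left_ne_zero_of_mul h0)) (right_ne_zero_of_mul h0)
    rw [← hcd] at hl
    obtain ⟨s, -, hs, rfl⟩ := hat a ha
    obtain ⟨t, -, ht, rfl⟩ := hat b hb
    have hst : NFactorization (s.prod * t.prod) (s ++ t) :=
      ⟨List.forall_mem_append.2 ⟨hs, ht⟩, by simp⟩
    obtain ⟨σ, hσ⟩ := huniq _ hab _ _ hl hst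
    obtain ⟨i, rfl⟩ := List.get_of_mem hpl
    have hdvd := hpy.pDvd.trans (hσ i).symm.pDvd
    exact (List.mem_append.1 (List.get_mem (s ++ t) (σ i))).imp
      (fun h => hdvd.trans (.of_mem_list h)) (fun h => hdvd.trans (.of_mem_list h))
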